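/- There exists ε₃ > 0 such that for every ε ∈ (0, ε₃) there is a constant a(ε) > 0 with: for all n, with probability at least 1 − 5·e^{−a(ε)·n} − 4·e^{−2(0.8ε)²·ε·n}, every optimal alignment v = (v_1,…,v_k) of X and Y satisfies k ≥ 0.1·ε²·n and |v_1| + ⋯ + |v_k| ≤ 2k (i.e. every optimal alignment belongs to V_n = ∪_{k ≥ 0.1ε²n} {v ∈ ℤ^k : |v_1| + ⋯ + |v_k| ≤ 2k}). -/

import Mathlib

open scoped BigOperators
open Classical

noncomputable section

/-- Length of a longest common subsequence of two boolean lists. -/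
def lcsLen (x y : List Bool) : ℕ :=
  sSup {k : ℕ | ∃ z : List Bool, z.length = k ∧ z.Sublist x ∧ z.Sublist y}

/-- Bernoulli(ε) product weight of a binary string. -/
def wt (ε : ℝ) {n : ℕ} (x : Fin n → Bool) : ℝ :=
  ∏ i, if x i then ε else 1 - ε

/-- Probability of an event about two independent i.i.d. Bernoulli(ε) strings of length n. -/
def pr (ε : ℝ) (n : ℕ) (E : (Fin n → Bool) → (Fin n → Bool) → Prop) : ℝ :=
  ∑ x : Fin n → Bool, ∑ y : Fin n → Bool, if E x y then wt ε x * wt ε y else 0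

/-- Number of zeros of x among positions a, a+1, …, b. -/
def zeroCount (x : ℕ → Bool) (a b : ℕ) : ℕ :=
  ((Finset.Icc a b).filter fun i => x i = false).card

/-- The pair (s, t) is a candidate next pair of matched ones after (p, q), for the
zero-difference u. -/
def StepProp (x y : ℕ → Bool) (n : ℕ) (u : ℤ) (p q s t : ℕ) : Prop :=
  p < s ∧ q < t ∧ s ≤ n ∧ t ≤ n ∧ x s = true ∧ y t = true ∧
    (zeroCount x (p + 1) s : ℤ) - (zeroCount y (q + 1) t : ℤ) = u

/-- π, ν realize the alignment associated with the vector v. -/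
def IsAlignment (x y : ℕ → Bool) (n : ℕ) (v : List ℤ) (piF nuF : ℕ → ℕ) : Prop :=
  piF 0 = 0 ∧ nuF 0 = 0 ∧
    ∀ i : ℕ, ∀ hi : i < v.length,
      StepProp x y n (v.get ⟨i, hi⟩) (piF i) (nuF i) (piF (i + 1)) (nuF (i + 1)) ∧
      ∀ s t : ℕ, StepProp x y n (v.get ⟨i, hi⟩) (piF i) (nuF i) s t →
        piF (i + 1) < s ∨ (piF (i + 1) = s ∧ nuF (i + 1) ≤ t)

/-- The score of the alignment v (realized by π, ν). -/
def score (x y : ℕ → Bool) (n : ℕ) (v : List ℤ) (piF nuF : ℕ → ℕ) : ℕ :=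
  v.length +
    (∑ i ∈ Finset.range v.length,
      min (zeroCount x (piF i + 1) (piF (i + 1))) (zeroCount y (nuF i + 1) (nuF (i + 1)))) +
    min (zeroCount x (piF v.length + 1) n) (zeroCount y (nuF v.length + 1) n)

/-- LCS length of the strings (x 1, …, x n) and (y 1, …, y n). -/
def lcsN (x y : ℕ → Bool) (n : ℕ) : ℕ :=
  lcsLen (List.ofFn fun i : Fin n => x (i.val + 1)) (List.ofFn fun i : Fin n => y (i.val + 1))

/-- View a string of length n (indexed by Fin n) as a function ℕ → Bool on positions 1, …, n. -/
def ext {n : ℕ} (x : Fin n → Bool) : ℕ → Bool :=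
  fun i => if h : i - 1 < n ∧ 1 ≤ i then x ⟨i - 1, h.1⟩ else false

/-- Number of matched ones in the zero-synchronized alignment. -/
def mOnes : List Bool → List Bool → ℕ
  | true :: x, true :: y => 1 + mOnes x y
  | false :: x, false :: y => mOnes x y
  | true :: x, false :: y => mOnes x (false :: y)
  | false :: x, true :: y => mOnes (false :: x) y
  | [], _ => 0
  | _ :: _, [] => 0
termination_by x y => x.length + y.length

lemma mOnes_nil_right (x : List Bool) : mOnes x [] = 0 := by
  cases x <;> simp [mOnes]

lemma mOnes_nil_left (x : List Bool) : mOnes [] x = 0 := by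
  simp [mOnes]

lemma exists_common (x y : List Bool) : ∃ z : List Bool, z.Sublist x ∧ z.Sublist y ∧
    min (x.count false) (y.count false) + mOnes x y ≤ z.length := by
  fun_induction mOnes x y with
  | case1 x y ih =>
    obtain ⟨z, h1, h2, h3⟩ := ih
    exact ⟨true :: z, h1.cons_cons _, h2.cons_cons _, by simp at *; omega⟩
  | case2 x y ih =>
    obtain ⟨z, h1, h2, h3⟩ := ih
    exact ⟨false :: z, h1.cons_cons _, h2.cons_cons _, by simp at *; omega⟩
  | case3 x y ih =>
    obtain ⟨z, h1, h2, h3⟩ := ih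
    exact ⟨z, h1.cons _, h2, by simp at *; omega⟩
  | case4 x y ih =>
    obtain ⟨z, h1, h2, h3⟩ := ih
    exact ⟨z, h1, h2.cons _, by simp at *; omega⟩
  | case5 y => exact ⟨[], by simp, by simp, by simp⟩
  | case6 a x => exact ⟨[], by simp, by simp, by simp⟩

lemma lcsLen_ge (x y : List Bool) :
    min (x.count false) (y.count false) + mOnes x y ≤ lcsLen x y := by
  obtain ⟨z, h1, h2, h3⟩ := exists_common x y
  refine h3.trans (le_csSup ⟨x.length, ?_⟩ ⟨z, rfl, h1, h2⟩)
  rintro k ⟨w, rfl, hw, -⟩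
  exact hw.length_le

lemma zeroCount_add (x : ℕ → Bool) (a b c : ℕ) (hab : a ≤ b) (hbc : b ≤ c) :
    zeroCount x (a + 1) b + zeroCount x (b + 1) c = zeroCount x (a + 1) c := by
  unfold zeroCount
  rw [← Finset.card_union_of_disjoint]
  · congr 1
    ext i
    simp only [Finset.mem_union, Finset.mem_filter, Finset.mem_Icc]
    constructor
    · rintro (h | h) <;> exact ⟨by omega, h.2⟩
    · rintro ⟨h, h'⟩
      rcases le_or_gt i b with hi | hi
      · exact Or.inl ⟨by omega, h'⟩
      · exact Or.inr ⟨by omega, h'⟩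
  · rw [Finset.disjoint_left]
    intro i hi hj
    simp only [Finset.mem_filter, Finset.mem_Icc] at hi hj
    omega

lemma align_sum (x y : ℕ → Bool) (n : ℕ) (v : List ℤ) (p q : ℕ → ℕ)
    (h : IsAlignment x y n v p q) (k : ℕ) (hk : k ≤ v.length) :
    p k ≤ n ∧ q k ≤ n ∧
    2 * (∑ i ∈ Finset.range k,
      min (zeroCount x (p i + 1) (p (i + 1))) (zeroCount y (q i + 1) (q (i + 1)))) +
      ((v.take k).map Int.natAbs).sum = zeroCount x 1 (p k) + zeroCount y 1 (q k) := by
  induction k with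
  | zero => simp [h.1, h.2.1, zeroCount]
  | succ k ih =>
    obtain ⟨i1, i2, i3⟩ := ih (by omega)
    obtain ⟨⟨s1, s2, s3, s4, -, -, s5⟩, -⟩ := h.2.2 k (by omega)
    refine ⟨s3, s4, ?_⟩
    have e1 := zeroCount_add x 0 (p k) (p (k + 1)) (by omega) (by omega)
    have e2 := zeroCount_add y 0 (q k) (q (k + 1)) (by omega) (by omega)
    have e3 : (v.take (k + 1)).map Int.natAbs = (v.take k).map Int.natAbs ++
        [(v.get ⟨k, by omega⟩).natAbs] := by
      rw [List.take_add_one, List.getElem?_eq_getElem (by omega), List.map_append]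
      rfl
    rw [Finset.sum_range_succ, e3, List.sum_append, List.sum_singleton]
    simp only [zero_add] at e1 e2
    omega

lemma score_le (x y : ℕ → Bool) (n : ℕ) (v : List ℤ) (p q : ℕ → ℕ)
    (h : IsAlignment x y n v p q) :
    2 * score x y n v p q + (v.map Int.natAbs).sum ≤
      2 * v.length + zeroCount x 1 n + zeroCount y 1 n := by
  obtain ⟨i1, i2, i3⟩ := align_sum x y n v p q h v.length le_rfl
  have e1 := zeroCount_add x 0 (p v.length) n (by omega) (by omega)
  have e2 := zeroCount_add y 0 (q v.length) n (by omega) (by omega)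
  simp only [zero_add] at e1 e2
  rw [List.take_length] at i3
  unfold score
  omega

lemma ext_ofFn {n : ℕ} (X : Fin n → Bool) :
    (List.ofFn fun i : Fin n => ext X (i.val + 1)) = List.ofFn X := by
  congr 1
  funext i
  simp [ext]

lemma zeroCount_eq_count (x : ℕ → Bool) (n : ℕ) :
    zeroCount x 1 n = (List.ofFn fun i : Fin n => x (i.val + 1)).count false := by
  induction n with
  | zero => simp [zeroCount]
  | succ n ih =>
    have e := zeroCount_add x 0 n (n + 1) (by omega) (by omega)
    rw [zero_add] at e
    rw [← e, ih, List.ofFn_succ', List.concat_eq_append, List.count_append]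
    simp only [Fin.val_castSucc, Fin.val_last]
    congr 1
    cases hx : x (n + 1) <;> simp [zeroCount, hx, Finset.filter_singleton]

/-- Expectation over a random list of length p. -/
def EX (ε : ℝ) : ℕ → (List Bool → ℝ) → ℝ
  | 0, f => f []
  | p + 1, f => ε * EX ε p (fun x => f (true :: x)) + (1 - ε) * EX ε p (fun x => f (false :: x))

lemma sum_wt (ε : ℝ) (n : ℕ) (f : List Bool → ℝ) :
    ∑ x : Fin n → Bool, wt ε x * f (List.ofFn x) = EX ε n f := by
  induction n generalizing f with
  | zero => simp [EX, wt]
  | succ n ih =>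
    rw [← (Fin.consEquiv (fun _ : Fin (n + 1) => Bool)).sum_comp, Fintype.sum_prod_type]
    simp only [Fintype.sum_bool, EX, ← ih, Finset.mul_sum]
    congr 1 <;>
    · apply Finset.sum_congr rfl
      intro x _
      simp [wt, Fin.consEquiv, Fin.prod_univ_succ, List.ofFn_succ, mul_assoc]

lemma EX_const (ε : ℝ) (n : ℕ) (c : ℝ) : EX ε n (fun _ => c) = c := by
  induction n with
  | zero => rfl
  | succ n ih => simp only [EX, ih]; ring

lemma EX_add (ε : ℝ) (n : ℕ) (f g : List Bool → ℝ) :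
    EX ε n (fun x => f x + g x) = EX ε n f + EX ε n g := by
  induction n generalizing f g with
  | zero => rfl
  | succ n ih => simp only [EX, ih]; ring

lemma EX_mul (ε : ℝ) (n : ℕ) (c : ℝ) (f : List Bool → ℝ) :
    EX ε n (fun x => c * f x) = c * EX ε n f := by
  induction n generalizing f with
  | zero => rfl
  | succ n ih => simp only [EX, ih]; ring

lemma EX_exp (ε t : ℝ) (n : ℕ) :
    EX ε n (fun x => Real.exp (t * (x.count false : ℝ))) =
      (ε + (1 - ε) * Real.exp t) ^ n := by
  induction n with
  | zero => simp [EX]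
  | succ n ih =>
    have h : ∀ x : List Bool, Real.exp (t * ((false :: x).count false : ℝ)) =
        Real.exp t * Real.exp (t * (x.count false : ℝ)) := by
      intro x
      rw [← Real.exp_add]; congr 1; simp; ring
    have h' : ∀ x : List Bool, ((true :: x).count false) = x.count false := by
      intro x; simp
    simp only [EX, h, h', EX_mul, ih]
    ring

/-- Expectation over two independent random lists. -/
def EE (ε : ℝ) (p q : ℕ) (F : List Bool → List Bool → ℝ) : ℝ :=
  EX ε p (fun x => EX ε q (fun y => F x y))

lemma EE_succ_left (ε : ℝ) (p q : ℕ) (F : List Bool → List Bool → ℝ) :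
    EE ε (p + 1) q F = ε * EE ε p q (fun x y => F (true :: x) y) +
      (1 - ε) * EE ε p q (fun x y => F (false :: x) y) := rfl

lemma EE_succ_right (ε : ℝ) (p q : ℕ) (F : List Bool → List Bool → ℝ) :
    EE ε p (q + 1) F = ε * EE ε p q (fun x y => F x (true :: y)) +
      (1 - ε) * EE ε p q (fun x y => F x (false :: y)) := by
  simp only [EE, EX, EX_add, EX_mul]

lemma EE_mul (ε : ℝ) (p q : ℕ) (c : ℝ) (F : List Bool → List Bool → ℝ) :
    EE ε p q (fun x y => c * F x y) = c * EE ε p q F := by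
  simp only [EE, EX_mul]

lemma EE_add (ε : ℝ) (p q : ℕ) (F G : List Bool → List Bool → ℝ) :
    EE ε p q (fun x y => F x y + G x y) = EE ε p q F + EE ε p q G := by
  simp only [EE, EX_add]

lemma sum_wt2 (ε : ℝ) (n : ℕ) (F : List Bool → List Bool → ℝ) :
    ∑ x : Fin n → Bool, ∑ y : Fin n → Bool,
      wt ε x * wt ε y * F (List.ofFn x) (List.ofFn y) = EE ε n n F := by
  rw [EE, ← sum_wt]
  apply Finset.sum_congr rfl
  intro x _
  rw [← sum_wt, Finset.mul_sum]
  apply Finset.sum_congr rfl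
  intro y _
  ring

lemma mOnes_moment (ε : ℝ) (h0 : 0 < ε) (h1 : ε < 1 / 10) (p q : ℕ) :
    EE ε p q (fun x y => (1 / 2 : ℝ) ^ mOnes x y) ≤
      (1 - ε ^ 2 / 3) ^ p + (1 - ε ^ 2 / 3) ^ q ∧
    EE ε p q (fun x y => (1 / 2 : ℝ) ^ mOnes x (false :: y)) ≤
      (1 + ε ^ 2) * (1 - ε ^ 2 / 3) ^ p + (1 - ε ^ 2 / 3) ^ q ∧
    EE ε p q (fun x y => (1 / 2 : ℝ) ^ mOnes (false :: x) y) ≤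
      (1 - ε ^ 2 / 3) ^ p + (1 + ε ^ 2) * (1 - ε ^ 2 / 3) ^ q := by
  have hα : 0 < 1 - ε ^ 2 / 3 := by nlinarith
  have hb : (1 - ε) + ε * (1 + ε ^ 2) ≤ (1 + ε ^ 2) * (1 - ε ^ 2 / 3) := by
    nlinarith [mul_pos h0 h0, mul_pos (mul_pos h0 h0) h0, mul_pos (mul_pos h0 h0) (sub_pos.2 h1),
      mul_pos (mul_pos (mul_pos h0 h0) h0) (sub_pos.2 h1)]
  have hc : ε ^ 2 * (1 / 2) + (1 - ε) ^ 2 + ε * (1 - ε) * (1 + (1 + ε ^ 2)) ≤ 1 - ε ^ 2 / 3 := by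
    nlinarith [mul_pos h0 h0, mul_pos (mul_pos h0 h0) h0, mul_pos (mul_pos h0 h0) (sub_pos.2 h1),
      sq_nonneg (ε ^ 2)]
  generalize hα' : 1 - ε ^ 2 / 3 = α at *
  have hsq : 0 < ε ^ 2 := by positivity
  generalize hbb : 1 + ε ^ 2 = b at *
  have hb1 : 1 ≤ b := by linarith
  have h1e : 0 < 1 - ε := by linarith
  induction hN : p + q using Nat.strong_induction_on generalizing p q with
  | _ N ih =>
    refine ⟨?_, ?_, ?_⟩
    · rcases p with _ | p
      · simp only [EE, EX, mOnes_nil_left, pow_zero, EX_const]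
        have := pow_pos hα q
        linarith
      rcases q with _ | q
      · simp only [EE, EX, mOnes_nil_right, pow_zero, EX_const]
        have := pow_pos hα (p + 1)
        linarith
      obtain ⟨A, B, C⟩ := ih (p + q) (by omega) p q rfl
      rw [EE_succ_left, EE_succ_right, EE_succ_right]
      simp only [mOnes, pow_add, pow_one, EE_mul]
      have hP := pow_pos hα p
      have hQ := pow_pos hα q
      generalize α ^ p = P at *
      generalize α ^ q = Q at *
      have k0 := mul_le_mul_of_nonneg_right hc (add_pos hP hQ).le
      have k1 := mul_le_mul_of_nonneg_left A (by positivity : 0 ≤ ε ^ 2 * (1 / 2) + (1 - ε) ^ 2)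
      have k2 := mul_le_mul_of_nonneg_left B (by positivity : 0 ≤ ε * (1 - ε))
      have k3 := mul_le_mul_of_nonneg_left C (by positivity : 0 ≤ ε * (1 - ε))
      linarith
    · rcases p with _ | p
      · simp only [EE, EX, mOnes_nil_left, pow_zero, EX_const]
        have := pow_pos hα q
        linarith
      obtain ⟨A, B, C⟩ := ih (p + q) (by omega) p q rfl
      rw [EE_succ_left]
      simp only [mOnes, pow_add, pow_one]
      have hP := pow_pos hα p
      have k0 := mul_le_mul_of_nonneg_right hb hP.le
      have k1 := mul_le_mul_of_nonneg_left A h1e.le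
      have k2 := mul_le_mul_of_nonneg_left B h0.le
      linarith
    · rcases q with _ | q
      · simp only [EE, EX, mOnes_nil_right, pow_zero, EX_const]
        have := pow_pos hα p
        linarith
      obtain ⟨A, B, C⟩ := ih (p + q) (by omega) p q rfl
      rw [EE_succ_right]
      simp only [mOnes, pow_add, pow_one]
      have hP := pow_pos hα q
      have k0 := mul_le_mul_of_nonneg_right hb hP.le
      have k1 := mul_le_mul_of_nonneg_left A h1e.le
      have k2 := mul_le_mul_of_nonneg_left C h0.le
      linarith

lemma diff_moment (ε t : ℝ) (h0 : 0 < ε) (h1 : ε < 1 / 10) (ht : |t| ≤ 1) (n : ℕ) :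
    EE ε n n (fun x y => Real.exp (t * ((x.count false : ℝ) - (y.count false : ℝ)))) ≤
      Real.exp (2 * ε * t ^ 2 * n) := by
  have h : ∀ x y : List Bool, Real.exp (t * ((x.count false : ℝ) - (y.count false : ℝ))) =
      Real.exp (t * (x.count false : ℝ)) * Real.exp ((-t) * (y.count false : ℝ)) := by
    intro x y
    rw [← Real.exp_add]; congr 1; ring
  have h2 : EE ε n n (fun x y => Real.exp (t * ((x.count false : ℝ) - (y.count false : ℝ)))) =
      ((ε + (1 - ε) * Real.exp t) * (ε + (1 - ε) * Real.exp (-t))) ^ n := by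
    simp only [EE, h, EX_mul, EX_exp]
    simp only [mul_comm _ ((ε + (1 - ε) * Real.exp (-t)) ^ n), EX_mul, EX_exp]
    rw [mul_pow, mul_comm]
  rw [h2, mul_comm (2 * ε * t ^ 2) (n : ℝ), Real.exp_nat_mul]
  have e1 := (abs_le.1 (Real.abs_exp_sub_one_sub_id_le ht)).2
  have e2 := (abs_le.1 (Real.abs_exp_sub_one_sub_id_le (x := -t) (by rwa [abs_neg]))).2
  have e3 : Real.exp t * Real.exp (-t) = 1 := by rw [← Real.exp_add]; simp
  have h1e : 0 < 1 - ε := by linarith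
  apply pow_le_pow_left₀
  · positivity
  refine le_trans ?_ (Real.add_one_le_exp _)
  have e4 : (ε + (1 - ε) * Real.exp t) * (ε + (1 - ε) * Real.exp (-t)) =
      1 + ε * (1 - ε) * (Real.exp t + Real.exp (-t) - 2) := by
    linear_combination (1 - ε) ^ 2 * e3
  rw [e4]
  have e5 : Real.exp t + Real.exp (-t) - 2 ≤ 2 * t ^ 2 := by linarith [neg_sq t]
  have e6 := mul_le_mul_of_nonneg_left e5 (by positivity : 0 ≤ ε * (1 - ε))
  nlinarith [mul_nonneg (sq_nonneg ε) (sq_nonneg t)]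

lemma good_of (ε : ℝ) (n : ℕ) (X Y : Fin n → Bool)
    (hM : 0.2 * ε ^ 2 * n ≤ (mOnes (List.ofFn X) (List.ofFn Y) : ℝ))
    (hD : |((List.ofFn X).count false : ℝ) - ((List.ofFn Y).count false : ℝ)| ≤ 0.2 * ε ^ 2 * n)
    (v : List ℤ) (piF nuF : ℕ → ℕ) (hA : IsAlignment (ext X) (ext Y) n v piF nuF)
    (hS : score (ext X) (ext Y) n v piF nuF = lcsN (ext X) (ext Y) n) :
    0.1 * ε ^ 2 * n ≤ (v.length : ℝ) ∧ (v.map Int.natAbs).sum ≤ 2 * v.length := by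
  have h1 := score_le _ _ _ _ _ _ hA
  have h2 := lcsLen_ge (List.ofFn X) (List.ofFn Y)
  rw [hS, lcsN, zeroCount_eq_count, zeroCount_eq_count, ext_ofFn, ext_ofFn] at h1
  generalize (List.ofFn X).count false = A at *
  generalize (List.ofFn Y).count false = B at *
  have h3 : 2 * min A B + 2 * mOnes (List.ofFn X) (List.ofFn Y) + (v.map Int.natAbs).sum ≤
      2 * v.length + A + B := by omega
  have h4 : (2 : ℝ) * min (A : ℝ) B + 2 * mOnes (List.ofFn X) (List.ofFn Y) +
      ((v.map Int.natAbs).sum : ℕ) ≤ 2 * v.length + A + B := by exact_mod_cast h3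
  have h5 : (2 : ℝ) * min (A : ℝ) B ≥ A + B - 0.2 * ε ^ 2 * n := by
    rw [abs_le] at hD
    rcases min_choice (A : ℝ) B with h | h <;> rw [h] <;> linarith [hD.1, hD.2]
  have h6 : 0 ≤ ε ^ 2 * n := by positivity
  have h7 : (0 : ℝ) ≤ ((v.map Int.natAbs).sum : ℕ) := Nat.cast_nonneg _
  constructor
  · linarith
  · have : (((v.map Int.natAbs).sum : ℕ) : ℝ) ≤ 2 * v.length := by linarith
    exact_mod_cast this

lemma wt_nonneg (ε : ℝ) (h0 : 0 < ε) (h1 : ε < 1 / 10) {n : ℕ} (x : Fin n → Bool) :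
    0 ≤ wt ε x := by
  apply Finset.prod_nonneg
  intro i _
  split_ifs <;> linarith

/-- Upper bound for the indicator of the bad event. -/
def bnd (ε : ℝ) (n : ℕ) (x y : List Bool) : ℝ :=
  Real.exp (0.14 * ε ^ 2 * n) * (1 / 2 : ℝ) ^ mOnes x y +
  (Real.exp (-(0.01 * ε ^ 3 * n)) *
      Real.exp ((0.05 * ε) * ((x.count false : ℝ) - (y.count false : ℝ))) +
    Real.exp (-(0.01 * ε ^ 3 * n)) *
      Real.exp ((-(0.05 * ε)) * ((x.count false : ℝ) - (y.count false : ℝ))))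

lemma bnd_ge (ε : ℝ) (n : ℕ) (h0 : 0 < ε) (x y : List Bool)
    (h : ¬ (0.2 * ε ^ 2 * n ≤ (mOnes x y : ℝ) ∧
      |(x.count false : ℝ) - (y.count false : ℝ)| ≤ 0.2 * ε ^ 2 * n)) : 1 ≤ bnd ε n x y := by
  have p1 : 0 ≤ Real.exp (0.14 * ε ^ 2 * n) * (1 / 2 : ℝ) ^ mOnes x y := by positivity
  have p2 := Real.exp_pos ((-(0.01 * ε ^ 3 * n)) +
    (0.05 * ε) * ((x.count false : ℝ) - (y.count false : ℝ)))
  have p3 := Real.exp_pos ((-(0.01 * ε ^ 3 * n)) +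
    (-(0.05 * ε)) * ((x.count false : ℝ) - (y.count false : ℝ)))
  unfold bnd
  rw [← Real.exp_add, ← Real.exp_add]
  by_cases hM : 0.2 * ε ^ 2 * n ≤ (mOnes x y : ℝ)
  · have hD : ¬ |(x.count false : ℝ) - (y.count false : ℝ)| ≤ 0.2 * ε ^ 2 * n :=
      fun hD => h ⟨hM, hD⟩
    rw [not_le, lt_abs] at hD
    rcases hD with hD | hD
    · have := mul_lt_mul_of_pos_left hD (by positivity : 0 < 0.05 * ε)
      have := Real.one_le_exp (x := (-(0.01 * ε ^ 3 * n)) +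
        (0.05 * ε) * ((x.count false : ℝ) - (y.count false : ℝ))) (by linarith)
      linarith
    · have := mul_lt_mul_of_pos_left hD (by positivity : 0 < 0.05 * ε)
      have := Real.one_le_exp (x := (-(0.01 * ε ^ 3 * n)) +
        (-(0.05 * ε)) * ((x.count false : ℝ) - (y.count false : ℝ))) (by linarith)
      linarith
  · have e : (1 / 2 : ℝ) ^ mOnes x y = Real.exp ((mOnes x y : ℝ) * (-Real.log 2)) := by
      rw [Real.exp_nat_mul, Real.exp_neg, Real.exp_log (by norm_num)]; norm_num
    have hl := Real.log_two_lt_d9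
    have hl0 : 0 < Real.log 2 := Real.log_pos (by norm_num)
    have : 1 ≤ Real.exp (0.14 * ε ^ 2 * n) * (1 / 2 : ℝ) ^ mOnes x y := by
      rw [e, ← Real.exp_add]
      apply Real.one_le_exp
      have hm : (0 : ℝ) ≤ mOnes x y := Nat.cast_nonneg _
      nlinarith
    linarith

lemma EE_bnd (ε : ℝ) (n : ℕ) (h0 : 0 < ε) (h1 : ε < 1 / 10) :
    EE ε n n (bnd ε n) ≤ 4 * Real.exp (-(0.005 * ε ^ 3) * n) := by
  have hn : (0 : ℝ) ≤ n := Nat.cast_nonneg _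
  unfold bnd
  rw [EE_add, EE_add, EE_mul, EE_mul, EE_mul]
  have a1 := (mOnes_moment ε h0 h1 n n).1
  have ht : |0.05 * ε| ≤ 1 := by rw [abs_of_pos (by positivity)]; linarith
  have a2 := diff_moment ε (0.05 * ε) h0 h1 ht n
  have a3 := diff_moment ε (-(0.05 * ε)) h0 h1 (by rwa [abs_neg]) n
  have b1 := mul_le_mul_of_nonneg_left a1 (Real.exp_pos (0.14 * ε ^ 2 * n)).le
  have b2 := mul_le_mul_of_nonneg_left a2 (Real.exp_pos (-(0.01 * ε ^ 3 * n))).le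
  have b3 := mul_le_mul_of_nonneg_left a3 (Real.exp_pos (-(0.01 * ε ^ 3 * n))).le
  rw [← Real.exp_add] at b2 b3
  have c2 : Real.exp (-(0.01 * ε ^ 3 * n) + 2 * ε * (0.05 * ε) ^ 2 * n) =
      Real.exp (-(0.005 * ε ^ 3) * n) := by congr 1; ring
  have c3 : Real.exp (-(0.01 * ε ^ 3 * n) + 2 * ε * (-(0.05 * ε)) ^ 2 * n) =
      Real.exp (-(0.005 * ε ^ 3) * n) := by congr 1; ring
  have d : (1 - ε ^ 2 / 3) ^ n ≤ Real.exp (n * (-(ε ^ 2 / 3))) := by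
    rw [Real.exp_nat_mul]
    apply pow_le_pow_left₀
    · nlinarith
    · linarith [Real.add_one_le_exp (-(ε ^ 2 / 3))]
  have d2 : Real.exp (0.14 * ε ^ 2 * n) * (1 - ε ^ 2 / 3) ^ n ≤
      Real.exp (-(0.005 * ε ^ 3) * n) := by
    refine (mul_le_mul_of_nonneg_left d (Real.exp_pos _).le).trans ?_
    rw [← Real.exp_add]
    apply Real.exp_le_exp.2
    have h2 : 0 ≤ ε ^ 2 * n := by positivity
    have h3 : ε ^ 3 * n ≤ ε ^ 2 * n := by
      have : ε * (ε ^ 2 * n) ≤ 1 * (ε ^ 2 * n) := mul_le_mul_of_nonneg_right (by linarith) h2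
      linarith
    linarith
  linarith

lemma pr_ge (ε : ℝ) (n : ℕ) (h0 : 0 < ε) (h1 : ε < 1 / 10)
    (E : (Fin n → Bool) → (Fin n → Bool) → Prop)
    (hE : ∀ X Y, (0.2 * ε ^ 2 * n ≤ (mOnes (List.ofFn X) (List.ofFn Y) : ℝ) ∧
      |((List.ofFn X).count false : ℝ) - ((List.ofFn Y).count false : ℝ)| ≤ 0.2 * ε ^ 2 * n) →
      E X Y) :
    1 - 4 * Real.exp (-(0.005 * ε ^ 3) * n) ≤ pr ε n E := by
  have e1 : EE ε n n (fun _ _ => (1 : ℝ)) = 1 := by simp only [EE, EX_const]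
  have e2 := EE_bnd ε n h0 h1
  have e3 : EE ε n n (fun x y => 1 + (-1) * bnd ε n x y) ≤ pr ε n E := by
    rw [← sum_wt2, pr]
    apply Finset.sum_le_sum
    intro X _
    apply Finset.sum_le_sum
    intro Y _
    have hw := mul_nonneg (wt_nonneg ε h0 h1 X) (wt_nonneg ε h0 h1 Y)
    have hb0 : 0 ≤ bnd ε n (List.ofFn X) (List.ofFn Y) := by unfold bnd; positivity
    split_ifs with hXY
    · nlinarith
    · have := bnd_ge ε n h0 (List.ofFn X) (List.ofFn Y) (fun h => hXY (hE X Y h))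
      nlinarith
  rw [EE_add, EE_mul, e1] at e3
  linarith

/-- There exists ε₃ > 0 such that for every ε ∈ (0, ε₃) there is a(ε) > 0 with: for all n,
with probability at least 1 − 5e^{−a n} − 4e^{−2(0.8ε)²εn}, every optimal alignment
v = (v₁,…,v_k) of X and Y satisfies k ≥ 0.1ε²n and |v₁| + ⋯ + |v_k| ≤ 2k. -/
theorem stmt9 :
    ∃ ε₃ : ℝ, 0 < ε₃ ∧ ε₃ ≤ 1 / 2 ∧
      ∀ ε : ℝ, 0 < ε → ε < ε₃ →
        ∃ a : ℝ, 0 < a ∧ ∀ n : ℕ,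
          1 - 5 * Real.exp (-a * n) - 4 * Real.exp (-2 * (0.8 * ε) ^ 2 * ε * n) ≤
            pr ε n (fun X Y =>
              ∀ (v : List ℤ) (piF nuF : ℕ → ℕ),
                IsAlignment (ext X) (ext Y) n v piF nuF →
                score (ext X) (ext Y) n v piF nuF = lcsN (ext X) (ext Y) n →
                0.1 * ε ^ 2 * n ≤ (v.length : ℝ) ∧
                  (v.map Int.natAbs).sum ≤ 2 * v.length) := by
  refine ⟨1 / 10, by norm_num, by norm_num, fun ε h0 h1 => ⟨0.005 * ε ^ 3, by positivity, ?_⟩⟩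
  intro n
  refine le_trans ?_ (pr_ge ε n h0 h1 _ fun X Y h => good_of ε n X Y h.1 h.2)
  have p1 := Real.exp_pos (-(0.005 * ε ^ 3) * n)
  have p2 := Real.exp_pos (-2 * (0.8 * ε) ^ 2 * ε * n)
  linarith
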